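/- arXiv:1410.7197 — 4 statements merged into one kernel-verified Lean document; each statement's English description precedes it below -/
import Mathlib

section
/- The constrained switching system S(G, M) is stable if and only if its constrained joint spectral radius satisfies ρ̂(G, M) < 1. -/
open Filter Matrix

/-- The operator norm on `n × n` real matrices induced by the Euclidean norm on `ℝ^n`. -/
noncomputable def euclOpNorm {n : ℕ} (A : Matrix (Fin n) (Fin n) ℝ) : ℝ :=
  ‖LinearMap.toContinuousLinearMap (Matrix.toEuclideanLin A)‖

/-- The Euclidean norm on `ℝ^n`. -/
noncomputable def euclNorm {n : ℕ} (x : Fin n → ℝ) : ℝ :=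
  Real.sqrt (∑ i, x i ^ 2)

/-- The matrix product `A_{σ(t-1)} ⋯ A_{σ(0)}` associated to a sequence of labels `σ`. -/
noncomputable def pathProd {n N : ℕ} (A : Fin N → Matrix (Fin n) (Fin n) ℝ)
    (t : ℕ) (σ : Fin t → Fin N) : Matrix (Fin n) (Fin n) ℝ :=
  (List.ofFn fun i => A (σ i)).reverse.prod

/-- `v, σ` describe a path of length `t` in the labeled graph with edge set `E`:
its `i`-th edge goes from node `v i` to node `v (i+1)` and carries the label `σ i`. -/
def IsPath {V : Type*} {N : ℕ} (E : Set (V × V × Fin N)) {t : ℕ}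
    (v : Fin (t + 1) → V) (σ : Fin t → Fin N) : Prop :=
  ∀ i : Fin t, (v i.castSucc, v i.succ, σ i) ∈ E

/-- The labeled graph with edge set `E` is strongly connected: any node can be joined to
any node by a path of length at least 1. -/
def StronglyConnected {V : Type*} {N : ℕ} (E : Set (V × V × Fin N)) : Prop :=
  ∀ u w : V, ∃ (t : ℕ) (v : Fin (t + 1) → V) (σ : Fin t → Fin N),
    1 ≤ t ∧ IsPath E v σ ∧ v 0 = u ∧ v (Fin.last t) = w

/-- The constrained joint spectral radius of the system `S(G, M)` with `G = (V, E)`, `M = A`. -/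
noncomputable def cjsr {V : Type*} {n N : ℕ} (E : Set (V × V × Fin N))
    (A : Fin N → Matrix (Fin n) (Fin n) ℝ) : ℝ :=
  Filter.atTop.limsup fun t : ℕ =>
    sSup { x : ℝ | ∃ (v : Fin (t + 1) → V) (σ : Fin t → Fin N),
      IsPath E v σ ∧ x = euclOpNorm (pathProd A t σ) ^ (1 / (t : ℝ)) }

/-- The constrained joint spectral radius of the `T`-lifted system `S(G_T, M^T)`:
paths of length `k` in `G_T` are exactly paths of length `k * T` in `G`. -/
noncomputable def cjsrLift {V : Type*} {n N : ℕ} (E : Set (V × V × Fin N))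
    (A : Fin N → Matrix (Fin n) (Fin n) ℝ) (T : ℕ) : ℝ :=
  Filter.atTop.limsup fun k : ℕ =>
    sSup { x : ℝ | ∃ (v : Fin (k * T + 1) → V) (σ : Fin (k * T) → Fin N),
      IsPath E v σ ∧ x = euclOpNorm (pathProd A (k * T) σ) ^ (1 / (k : ℝ)) }

/-- Stability of the constrained switching system: along every infinite path of the graph,
every trajectory converges to `0`. -/
def Stable {V : Type*} {n N : ℕ} (E : Set (V × V × Fin N))
    (A : Fin N → Matrix (Fin n) (Fin n) ℝ) : Prop :=
  ∀ (v : ℕ → V) (σ : ℕ → Fin N), (∀ t : ℕ, (v t, v (t + 1), σ t) ∈ E) →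
    ∀ x0 : Fin n → ℝ,
      Tendsto (fun t : ℕ => (pathProd A t fun i : Fin t => σ i).mulVec x0)
        atTop (nhds 0)

/-- `ν` is a family of norms on `ℝ^n` indexed by the nodes. -/
def IsNormFamily {V : Type*} {n : ℕ} (ν : V → (Fin n → ℝ) → ℝ) : Prop :=
  ∀ u : V,
    (∀ x y : Fin n → ℝ, ν u (x + y) ≤ ν u x + ν u y) ∧
    (∀ (a : ℝ) (x : Fin n → ℝ), ν u (a • x) = |a| * ν u x) ∧
    (∀ x : Fin n → ℝ, ν u x = 0 → x = 0)

/-- `ν` is a `γ`-multinorm for the system `S(G, M)`. -/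
def IsMultinorm {V : Type*} {n N : ℕ} (E : Set (V × V × Fin N))
    (A : Fin N → Matrix (Fin n) (Fin n) ℝ) (γ : ℝ)
    (ν : V → (Fin n → ℝ) → ℝ) : Prop :=
  IsNormFamily ν ∧
    ∀ vi vj : V, ∀ σ : Fin N, (vi, vj, σ) ∈ E →
      ∀ x : Fin n → ℝ, ν vj ((A σ).mulVec x) ≤ γ * ν vi x

/-- `Q` is a quadratic `γ`-multinorm for the system `S(G, M)`. -/
def IsQuadMultinorm {V : Type*} {n N : ℕ} (E : Set (V × V × Fin N))
    (A : Fin N → Matrix (Fin n) (Fin n) ℝ) (γ : ℝ)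
    (Q : V → Matrix (Fin n) (Fin n) ℝ) : Prop :=
  (∀ u : V, (Q u).PosDef) ∧
    ∀ vi vj : V, ∀ σ : Fin N, (vi, vj, σ) ∈ E →
      (γ ^ 2 • Q vi - (A σ)ᵀ * Q vj * A σ).PosSemidef

/-- `Q` is a quadratic `γ`-multinorm for the lifted system `S(G_T, M^T)`: the Loewner
inequality holds along every path of length `T` of `G` (i.e. every edge of `G_T`). -/
def IsQuadMultinormLift {V : Type*} {n N : ℕ} (E : Set (V × V × Fin N))
    (A : Fin N → Matrix (Fin n) (Fin n) ℝ) (T : ℕ) (γ : ℝ)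
    (Q : V → Matrix (Fin n) (Fin n) ℝ) : Prop :=
  (∀ u : V, (Q u).PosDef) ∧
    ∀ (v : Fin (T + 1) → V) (σ : Fin T → Fin N), IsPath E v σ →
      (γ ^ 2 • Q (v 0) -
        (pathProd A T σ)ᵀ * Q (v (Fin.last T)) * pathProd A T σ).PosSemidef

/-- `Q` is a path-dependent Lyapunov function with memory `T` for `S(G, M)`:
one positive definite quadratic form per path of length `T`, with a strict decrease
condition along every path of length `T + 1`. -/
def IsPathDepLyap {V : Type*} {n N : ℕ} (E : Set (V × V × Fin N))
    (A : Fin N → Matrix (Fin n) (Fin n) ℝ) (T : ℕ)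
    (Q : (Fin (T + 1) → V) → (Fin T → Fin N) → Matrix (Fin n) (Fin n) ℝ) : Prop :=
  (∀ (v : Fin (T + 1) → V) (σ : Fin T → Fin N), IsPath E v σ → (Q v σ).PosDef) ∧
    ∀ (v : Fin (T + 2) → V) (σ : Fin (T + 1) → Fin N), IsPath E v σ →
      (Q (fun i : Fin (T + 1) => v i.castSucc) (fun i : Fin T => σ i.castSucc) -
        (A (σ (Fin.last T)))ᵀ *
          Q (fun i : Fin (T + 1) => v i.succ) (fun i : Fin T => σ i.succ) *
            A (σ (Fin.last T))).PosDef

/-- The joint spectral radius of a finite set of matrices (arbitrary switching). -/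
noncomputable def jsr {n N : ℕ} (A : Fin N → Matrix (Fin n) (Fin n) ℝ) : ℝ :=
  Filter.atTop.limsup fun t : ℕ =>
    sSup { x : ℝ | ∃ σ : Fin t → Fin N,
      x = euclOpNorm (pathProd A t σ) ^ (1 / (t : ℝ)) }

/-- The joint spectral radius of the set `M^T` of all products of `T` matrices from `M`:
products of `k` matrices from `M^T` are exactly products of `k * T` matrices from `M`. -/
noncomputable def jsrPow {n N : ℕ} (A : Fin N → Matrix (Fin n) (Fin n) ℝ) (T : ℕ) : ℝ :=
  Filter.atTop.limsup fun k : ℕ =>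
    sSup { x : ℝ | ∃ σ : Fin (k * T) → Fin N,
      x = euclOpNorm (pathProd A (k * T) σ) ^ (1 / (k : ℝ)) }

/-- The optimal value `γ*(G, M)` of the semidefinite program of Corollary 4.6. -/
noncomputable def gammaStar {V : Type*} {n N : ℕ} (E : Set (V × V × Fin N))
    (A : Fin N → Matrix (Fin n) (Fin n) ℝ) : ℝ :=
  sInf {γ : ℝ | 0 < γ ∧ ∃ Q : V → Matrix (Fin n) (Fin n) ℝ,
    (∀ u : V, (Q u).PosDef) ∧ ∀ vi vj : V, ∀ σ : Fin N, (vi, vj, σ) ∈ E →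
      (γ ^ 2 • Q vi - (A σ)ᵀ * Q vj * A σ).PosDef}

/-- The optimal value `γ*(G_T, M^T)` of the semidefinite program applied to the lifted
system `S(G_T, M^T)`. -/
noncomputable def gammaStarLift {V : Type*} {n N : ℕ} (E : Set (V × V × Fin N))
    (A : Fin N → Matrix (Fin n) (Fin n) ℝ) (T : ℕ) : ℝ :=
  sInf {γ : ℝ | 0 < γ ∧ ∃ Q : V → Matrix (Fin n) (Fin n) ℝ,
    (∀ u : V, (Q u).PosDef) ∧
      ∀ (v : Fin (T + 1) → V) (σ : Fin T → Fin N), IsPath E v σ →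
        (γ ^ 2 • Q (v 0) -
          (pathProd A T σ)ᵀ * Q (v (Fin.last T)) * pathProd A T σ).PosDef}

/-- Product along an infinite label sequence. -/
noncomputable def seqProd {n N : ℕ} (A : Fin N → Matrix (Fin n) (Fin n) ℝ)
    (s : ℕ → Fin N) : ℕ → Matrix (Fin n) (Fin n) ℝ
  | 0 => 1
  | t + 1 => A (s t) * seqProd A s t

lemma pathProd_eq_seqProd {n N : ℕ} (A : Fin N → Matrix (Fin n) (Fin n) ℝ)
    (s : ℕ → Fin N) (t : ℕ) : (pathProd A t fun i : Fin t => s i) = seqProd A s t := by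
  induction t with
  | zero => simp [pathProd, seqProd]
  | succ t ih =>
    rw [seqProd, ← ih]
    unfold pathProd
    rw [List.ofFn_succ_last]
    simp

lemma seqProd_add {n N : ℕ} (A : Fin N → Matrix (Fin n) (Fin n) ℝ)
    (s : ℕ → Fin N) (a b : ℕ) :
    seqProd A s (a + b) = seqProd A (fun i => s (a + i)) b * seqProd A s a := by
  induction b with
  | zero => simp [seqProd]
  | succ b ih => rw [← add_assoc, seqProd, ih, seqProd, Matrix.mul_assoc]

lemma euclOpNorm_nonneg {n : ℕ} (A : Matrix (Fin n) (Fin n) ℝ) : 0 ≤ euclOpNorm A :=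
  norm_nonneg _

lemma euclOpNorm_zero {n : ℕ} : euclOpNorm (0 : Matrix (Fin n) (Fin n) ℝ) = 0 := by
  simp [euclOpNorm]

lemma euclOpNorm_mulVec {n : ℕ} (A : Matrix (Fin n) (Fin n) ℝ) (x : Fin n → ℝ) :
    ‖WithLp.toLp 2 (A.mulVec x)‖ ≤ euclOpNorm A * ‖WithLp.toLp 2 x‖ := by
  have := (LinearMap.toContinuousLinearMap (Matrix.toEuclideanLin A)).le_opNorm (WithLp.toLp 2 x)
  simpa [euclOpNorm] using this

lemma euclOpNorm_mul {n : ℕ} (A B : Matrix (Fin n) (Fin n) ℝ) :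
    euclOpNorm (A * B) ≤ euclOpNorm A * euclOpNorm B := by
  refine ContinuousLinearMap.opNorm_le_bound _
    (mul_nonneg (euclOpNorm_nonneg A) (euclOpNorm_nonneg B)) fun x => ?_
  have h1 := euclOpNorm_mulVec A (B.mulVec x.ofLp)
  have h2 := euclOpNorm_mulVec B x.ofLp
  have h3 : ‖WithLp.toLp 2 ((A * B).mulVec x.ofLp)‖ ≤
      euclOpNorm A * euclOpNorm B * ‖WithLp.toLp 2 x.ofLp‖ := by
    rw [← Matrix.mulVec_mulVec, mul_assoc]
    exact h1.trans (mul_le_mul_of_nonneg_left h2 (euclOpNorm_nonneg A))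
  exact h3

lemma euclOpNorm_one_le {n : ℕ} : euclOpNorm (1 : Matrix (Fin n) (Fin n) ℝ) ≤ 1 := by
  refine ContinuousLinearMap.opNorm_le_bound _ zero_le_one fun x => ?_
  simp

lemma continuous_euclOpNorm {n : ℕ} :
    Continuous (euclOpNorm : Matrix (Fin n) (Fin n) ℝ → ℝ) := by
  have h : Continuous ((Matrix.toEuclideanLin (𝕜 := ℝ) (m := Fin n) (n := Fin n)).trans
      LinearMap.toContinuousLinearMap).toLinearMap :=
    LinearMap.continuous_of_finiteDimensional _
  exact continuous_norm.comp h

lemma exists_bound {n N : ℕ} (A : Fin N → Matrix (Fin n) (Fin n) ℝ) :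
    ∃ K : ℝ, 1 ≤ K ∧ ∀ s t, euclOpNorm (seqProd A s t) ≤ K ^ t := by
  refine ⟨1 + ∑ i, euclOpNorm (A i), ?_, ?_⟩
  · have : 0 ≤ ∑ i, euclOpNorm (A i) := Finset.sum_nonneg fun i _ => euclOpNorm_nonneg _
    linarith
  · intro s t
    have h0 : 0 ≤ ∑ i, euclOpNorm (A i) := Finset.sum_nonneg fun i _ => euclOpNorm_nonneg _
    induction t with
    | zero => simpa [seqProd] using euclOpNorm_one_le
    | succ t ih =>
      rw [seqProd, pow_succ']
      refine (euclOpNorm_mul _ _).trans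
        (mul_le_mul ?_ ih (euclOpNorm_nonneg _) (by linarith))
      have := Finset.single_le_sum (f := fun i => euclOpNorm (A i))
        (fun i _ => euclOpNorm_nonneg _) (Finset.mem_univ (s t))
      linarith

lemma path_extend {V : Type} {N : ℕ} (E : Set (V × V × Fin N)) (hconn : StronglyConnected E)
    {t : ℕ} (v : Fin (t + 1) → V) (σ : Fin t → Fin N) (h : IsPath E v σ) :
    ∃ (w : ℕ → V) (s : ℕ → Fin N), (∀ i, (w i, w (i + 1), s i) ∈ E) ∧
      σ = fun i : Fin t => s i := by
  have hout : ∀ u : V, ∃ (u' : V) (l : Fin N), (u, u', l) ∈ E := by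
    intro u
    obtain ⟨k, v, σ, hk, hp, h0, -⟩ := hconn u u
    obtain ⟨k, rfl⟩ : ∃ m, k = m + 1 := ⟨k - 1, by omega⟩
    refine ⟨v (Fin.succ 0), σ 0, ?_⟩
    have := hp 0
    rwa [Fin.castSucc_zero, h0] at this
  choose nx lab hE using hout
  let w : ℕ → V := fun i => if hi : i < t + 1 then v ⟨i, hi⟩ else nx^[i - t] (v (Fin.last t))
  refine ⟨w, fun i => if hi : i < t then σ ⟨i, hi⟩ else lab (w i), ?_, ?_⟩
  · intro i
    by_cases hi : i < t
    · have := h ⟨i, hi⟩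
      simp only [w, hi, dif_pos, show i < t + 1 by omega, show i + 1 < t + 1 by omega]
      exact this
    · have hw : w (i + 1) = nx (w i) := by
        have h1 : w (i + 1) = nx^[i + 1 - t] (v (Fin.last t)) := by
          simp only [w, show ¬ (i + 1 < t + 1) by omega, dif_neg, not_false_eq_true]
        have h2 : w i = nx^[i - t] (v (Fin.last t)) := by
          by_cases hi' : i < t + 1
          · have : i = t := by omega
            subst this
            simp [w, Fin.last]
          · simp only [w, hi', dif_neg, not_false_eq_true]
        rw [h1, h2, show i + 1 - t = (i - t) + 1 by omega, Function.iterate_succ_apply']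
      rw [hw]
      simp only [hi, dif_neg, not_false_eq_true]
      exact hE _
  · funext i
    simp

lemma stable_norm_tendsto {n N : ℕ} {V : Type}
    (E : Set (V × V × Fin N)) (A : Fin N → Matrix (Fin n) (Fin n) ℝ) (hS : Stable E A)
    (w : ℕ → V) (s : ℕ → Fin N) (hp : ∀ i, (w i, w (i + 1), s i) ∈ E) :
    Tendsto (fun t => euclOpNorm (seqProd A s t)) atTop (nhds 0) := by
  have h : Tendsto (fun t => seqProd A s t) atTop (nhds 0) := by
    refine tendsto_pi_nhds.2 fun i => tendsto_pi_nhds.2 fun j => ?_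
    have := (tendsto_pi_nhds.1 (hS w s hp (Pi.single j 1))) i
    simpa [pathProd_eq_seqProd] using this
  have := (continuous_euclOpNorm.tendsto (0 : Matrix (Fin n) (Fin n) ℝ)).comp h
  rwa [euclOpNorm_zero] at this

lemma stable_uniform {n N : ℕ} {V : Type} [Fintype V]
    (E : Set (V × V × Fin N)) (A : Fin N → Matrix (Fin n) (Fin n) ℝ) (hS : Stable E A) :
    ∃ T : ℕ, 1 ≤ T ∧ ∀ (w : ℕ → V) (s : ℕ → Fin N), (∀ i, (w i, w (i + 1), s i) ∈ E) →
      ∃ t, 1 ≤ t ∧ t ≤ T ∧ euclOpNorm (seqProd A s t) ≤ 1 / 2 := by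
  letI : TopologicalSpace V := ⊥
  haveI : DiscreteTopology V := ⟨rfl⟩
  let C : Set ((ℕ → V) × (ℕ → Fin N)) := {p | ∀ i, (p.1 i, p.1 (i + 1), p.2 i) ∈ E}
  have hC : IsClosed C := by
    have : C = ⋂ i, {p : (ℕ → V) × (ℕ → Fin N) | (p.1 i, p.1 (i + 1), p.2 i) ∈ E} := by
      ext p; simp [C]
    rw [this]
    refine isClosed_iInter fun i => ?_
    have hc : Continuous fun p : (ℕ → V) × (ℕ → Fin N) => (p.1 i, p.1 (i + 1), p.2 i) := by
      fun_prop
    exact (isClosed_discrete E).preimage hc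
  have hcont : ∀ t, Continuous fun p : (ℕ → V) × (ℕ → Fin N) => seqProd A p.2 t := by
    intro t
    induction t with
    | zero => exact continuous_const
    | succ t ih =>
      have h1 : Continuous fun p : (ℕ → V) × (ℕ → Fin N) => A (p.2 t) := by
        have : Continuous A := continuous_of_discreteTopology
        exact this.comp (by fun_prop)
      exact h1.matrix_mul ih
  let U : ℕ → Set ((ℕ → V) × (ℕ → Fin N)) :=
    fun t => {p | euclOpNorm (seqProd A p.2 (t + 1)) < 1 / 2}
  have hU : ∀ t, IsOpen (U t) := fun t =>
    isOpen_lt (continuous_euclOpNorm.comp (hcont (t + 1))) continuous_const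
  have hcov : C ⊆ ⋃ t, U t := by
    rintro ⟨w, s⟩ hp
    have h := (stable_norm_tendsto E A hS w s hp).eventually_lt_const
      (show (0 : ℝ) < 1 / 2 by norm_num)
    obtain ⟨t, ht⟩ := ((tendsto_add_atTop_nat 1).eventually h).exists
    exact Set.mem_iUnion.2 ⟨t, ht⟩
  obtain ⟨F, hF⟩ := hC.isCompact.elim_finite_subcover U hU hcov
  refine ⟨F.sup id + 1, by omega, fun w s hp => ?_⟩
  have := hF (show (w, s) ∈ C from hp)
  simp only [Set.mem_iUnion] at this
  obtain ⟨t, htF, ht⟩ := this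
  have hle : t ≤ F.sup id := Finset.le_sup (f := id) htF
  exact ⟨t + 1, by omega, by omega, le_of_lt ht⟩

lemma stable_exp {n N : ℕ} {V : Type} [Fintype V]
    (E : Set (V × V × Fin N)) (A : Fin N → Matrix (Fin n) (Fin n) ℝ) (hS : Stable E A) :
    ∃ C γ : ℝ, 0 < C ∧ 0 < γ ∧ γ < 1 ∧
      ∀ (w : ℕ → V) (s : ℕ → Fin N), (∀ i, (w i, w (i + 1), s i) ∈ E) →
      ∀ L, euclOpNorm (seqProd A s L) ≤ C * γ ^ L := by
  obtain ⟨T, hT, hu⟩ := stable_uniform E A hS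
  obtain ⟨K, hK, hb⟩ := exists_bound A
  have hT0 : (T : ℝ) ≠ 0 := by positivity
  let γ : ℝ := (1 / 2 : ℝ) ^ (1 / (T : ℝ))
  have hγ0 : 0 < γ := Real.rpow_pos_of_pos (by norm_num) _
  have hγ1 : γ < 1 := Real.rpow_lt_one (by norm_num) (by norm_num) (by positivity)
  have hγT : γ ^ T = 1 / 2 := by
    rw [← Real.rpow_natCast, ← Real.rpow_mul (by norm_num)]
    rw [one_div_mul_cancel hT0, Real.rpow_one]
  have hγt : ∀ t, t ≤ T → 1 / 2 ≤ γ ^ t := fun t ht => by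
    rw [← hγT]; exact pow_le_pow_of_le_one hγ0.le hγ1.le ht
  refine ⟨2 * K ^ T, γ, by positivity, hγ0, hγ1, ?_⟩
  intro w s hp L
  induction L using Nat.strong_induction_on generalizing w s with
  | _ L ih =>
  by_cases hL : L ≤ T
  · have h1 := hb s L
    have h2 : K ^ L ≤ K ^ T := pow_le_pow_right₀ hK hL
    have h3 := hγt L hL
    have h4 : 0 ≤ K ^ T := by positivity
    nlinarith
  · obtain ⟨t, ht1, htT, ht⟩ := hu w s hp
    obtain ⟨m, rfl⟩ : ∃ m, L = t + m := ⟨L - t, by omega⟩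
    have h1 := ih m (by omega) (fun i => w (t + i)) (fun i => s (t + i)) (fun i => hp (t + i))
    rw [seqProd_add]
    refine (euclOpNorm_mul _ _).trans ?_
    have h2 := mul_le_mul h1 (ht.trans (hγt t htT)) (euclOpNorm_nonneg _) (by positivity)
    refine h2.trans (le_of_eq ?_)
    rw [pow_add]; ring

/-- `S(G, M)` is stable iff `ρ̂(G, M) < 1`. -/
theorem stable_iff_cjsr_lt_one {n N : ℕ} (hn : 1 ≤ n) (hN : 1 ≤ N)
    {V : Type} [Fintype V] [Nonempty V]
    (E : Set (V × V × Fin N)) (A : Fin N → Matrix (Fin n) (Fin n) ℝ)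
    (hconn : StronglyConnected E) :
    Stable E A ↔ cjsr E A < 1 := by
  constructor
  · intro hS
    obtain ⟨C, γ, hC, hγ0, hγ1, hb⟩ := stable_exp E A hS
    have hlim : Tendsto (fun t : ℕ => C ^ (1 / (t : ℝ)) * γ) atTop (nhds γ) := by
      have h1 : Tendsto (fun t : ℕ => C ^ (1 / (t : ℝ))) atTop (nhds (C ^ (0 : ℝ))) :=
        ((Real.continuous_const_rpow hC.ne').tendsto 0).comp tendsto_one_div_atTop_nhds_zero_nat
      rw [Real.rpow_zero] at h1
      simpa using h1.mul_const γ
    obtain ⟨a, ha, ha1⟩ := exists_between hγ1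
    have hev := hlim.eventually_lt_const ha
    refine lt_of_le_of_lt ?_ ha1
    refine Filter.limsup_le_of_le ?_ ?_
    · refine Filter.IsCoboundedUnder.of_frequently_ge (a := 0) ?_
      refine Filter.Frequently.of_forall fun t => ?_
      refine Real.sSup_nonneg ?_
      rintro x ⟨v, σ, -, rfl⟩
      exact Real.rpow_nonneg (euclOpNorm_nonneg _) _
    · filter_upwards [hev, eventually_ge_atTop 1] with t ht ht1
      refine Real.sSup_le ?_ (hγ0.trans ha).le
      rintro x ⟨v, σ, hp, rfl⟩
      obtain ⟨w, s, hws, rfl⟩ := path_extend E hconn v σ hp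
      rw [pathProd_eq_seqProd]
      refine le_trans ?_ ht.le
      have h1 := Real.rpow_le_rpow (euclOpNorm_nonneg _) (hb w s hws t)
        (show (0 : ℝ) ≤ 1 / (t : ℝ) by positivity)
      refine h1.trans (le_of_eq ?_)
      rw [Real.mul_rpow hC.le (by positivity), one_div,
        Real.pow_rpow_inv_natCast hγ0.le (by omega)]
  · intro h w s hp x0
    obtain ⟨K, hK, hb⟩ := exists_bound A
    have hbd : ∀ t : ℕ, 1 ≤ t → ∀ x ∈ { x : ℝ | ∃ (v : Fin (t + 1) → V) (σ : Fin t → Fin N),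
        IsPath E v σ ∧ x = euclOpNorm (pathProd A t σ) ^ (1 / (t : ℝ)) }, x ≤ K := by
      rintro t ht x ⟨v, σ, hp, rfl⟩
      obtain ⟨w, s, hws, rfl⟩ := path_extend E hconn v σ hp
      rw [pathProd_eq_seqProd]
      have h1 := Real.rpow_le_rpow (euclOpNorm_nonneg _) (hb s t)
        (show (0 : ℝ) ≤ 1 / (t : ℝ) by positivity)
      refine h1.trans (le_of_eq ?_)
      rw [one_div, Real.pow_rpow_inv_natCast (by linarith) (by omega)]
    obtain ⟨a, ha, ha1⟩ := exists_between (max_lt h (zero_lt_one (α := ℝ)))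
    have ha0 : 0 < a := (le_max_right _ _).trans_lt ha
    have hev := Filter.eventually_lt_of_limsup_lt ((le_max_left _ _).trans_lt ha)
      (Filter.isBoundedUnder_of_eventually_le (a := K) (by
        filter_upwards [eventually_ge_atTop 1] with t ht
        exact Real.sSup_le (hbd t ht) (by linarith)))
    have hle : ∀ᶠ t : ℕ in atTop, euclOpNorm (seqProd A s t) ≤ a ^ t := by
      filter_upwards [hev, eventually_ge_atTop 1] with t ht ht1
      have h1 : euclOpNorm (seqProd A s t) ^ (1 / (t : ℝ)) ≤ a := by
        refine le_trans (le_csSup ⟨K, fun x hx => hbd t ht1 x hx⟩ ?_) ht.le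
        exact ⟨fun i => w i, fun i => s i, fun i => by simpa using hp i,
          by rw [pathProd_eq_seqProd]⟩
      have h2 := pow_le_pow_left₀ (Real.rpow_nonneg (euclOpNorm_nonneg _) _) h1 t
      rwa [one_div, Real.rpow_inv_natCast_pow (euclOpNorm_nonneg _) (by omega)] at h2
    refine tendsto_pi_nhds.2 fun i => ?_
    have hz : Tendsto (fun t : ℕ => a ^ t * ‖WithLp.toLp 2 x0‖) atTop (nhds 0) := by
      simpa using (tendsto_pow_atTop_nhds_zero_of_lt_one ha0.le ha1).mul_const
        ‖WithLp.toLp 2 x0‖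
    refine squeeze_zero_norm' ?_ hz
    filter_upwards [hle] with t ht
    rw [pathProd_eq_seqProd]
    have h1 := PiLp.norm_apply_le (WithLp.toLp 2 ((seqProd A s t).mulVec x0)) i
    exact h1.trans ((euclOpNorm_mulVec _ _).trans
      (mul_le_mul_of_nonneg_right ht (norm_nonneg _)))
end

section
/- If the system S(G, M) admits a γ-multinorm for some γ > 0, then ρ̂(G, M) ≤ γ. -/
open Filter Matrix

/-- Every norm on `ℝ^n` is equivalent to the Euclidean one. -/
theorem seminorm_equiv {n : ℕ} (p : Seminorm ℝ (EuclideanSpace ℝ (Fin n)))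
    (hp : ∀ x, p x = 0 → x = 0) :
    ∃ K : ℝ, 1 ≤ K ∧ ∀ x, p x ≤ K * ‖x‖ ∧ ‖x‖ ≤ K * p x := by
  have hc : Continuous p := by
    rw [← continuousOn_univ]
    exact (p.convexOn).continuousOn isOpen_univ
  have hK : IsCompact (Metric.sphere (0 : EuclideanSpace ℝ (Fin n)) 1) := isCompact_sphere 0 1
  obtain ⟨C, hC⟩ := hK.exists_bound_of_continuousOn hc.continuousOn
  have hne : ∀ x ∈ Metric.sphere (0 : EuclideanSpace ℝ (Fin n)) 1, p x ≠ 0 := by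
    intro x hx h
    have := hp x h
    subst this
    simp at hx
  obtain ⟨D, hD⟩ := hK.exists_bound_of_continuousOn (hc.continuousOn.inv₀ hne)
  refine ⟨max 1 (max C D), le_max_left _ _, fun x => ?_⟩
  by_cases hx : x = 0
  · subst hx; simp
  have hx' : 0 < ‖x‖ := norm_pos_iff.mpr hx
  have hmem : (‖x‖⁻¹ • x) ∈ Metric.sphere (0 : EuclideanSpace ℝ (Fin n)) 1 := by
    simp [norm_smul, hx'.ne']
  have e : p (‖x‖⁻¹ • x) = ‖x‖⁻¹ * p x := by
    rw [map_smul_eq_mul]; simp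
  have h1 := hC _ hmem
  have h2 := hD _ hmem
  have hpx : 0 < p x := lt_of_le_of_ne (apply_nonneg p x) (fun h => hx (hp x h.symm))
  have h1' : ‖x‖⁻¹ * p x ≤ max 1 (max C D) := by
    rw [← e]
    exact (le_abs_self _).trans (h1.trans ((le_max_left _ _).trans (le_max_right _ _)))
  have h2' : ‖x‖ * (p x)⁻¹ ≤ max 1 (max C D) := by
    have : (p (‖x‖⁻¹ • x))⁻¹ = ‖x‖ * (p x)⁻¹ := by
      rw [e, mul_inv, inv_inv]
    rw [← this]
    exact (le_abs_self _).trans (h2.trans ((le_max_right _ _).trans (le_max_right _ _)))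
  constructor
  · rwa [inv_mul_le_iff₀ hx', mul_comm] at h1'
  · rwa [← div_eq_mul_inv, div_le_iff₀ hpx] at h2'

theorem pathProd_succ {n N : ℕ} (A : Fin N → Matrix (Fin n) (Fin n) ℝ)
    (t : ℕ) (σ : Fin (t + 1) → Fin N) :
    pathProd A (t + 1) σ = A (σ (Fin.last t)) * pathProd A t (fun i => σ i.castSucc) := by
  unfold pathProd
  rw [List.ofFn_succ']
  simp

theorem multinorm_path {n N : ℕ} {V : Type} (E : Set (V × V × Fin N))
    (A : Fin N → Matrix (Fin n) (Fin n) ℝ) (γ : ℝ) (hγ : 0 < γ) (ν : V → (Fin n → ℝ) → ℝ)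
    (hν : IsMultinorm E A γ ν) (t : ℕ) (v : Fin (t + 1) → V) (σ : Fin t → Fin N)
    (h : IsPath E v σ) (x : Fin n → ℝ) :
    ν (v (Fin.last t)) ((pathProd A t σ).mulVec x) ≤ γ ^ t * ν (v 0) x := by
  induction t with
  | zero => simp [pathProd]
  | succ t ih =>
    have ih' := ih (fun i => v i.castSucc) (fun i => σ i.castSucc) (fun i => h i.castSucc)
    rw [pathProd_succ, ← Matrix.mulVec_mulVec]
    have h1 := hν.2 _ _ _ (h (Fin.last t)) ((pathProd A t fun i => σ i.castSucc).mulVec x)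
    rw [Fin.succ_last] at h1
    refine h1.trans ?_
    rw [pow_succ', mul_assoc]
    exact mul_le_mul_of_nonneg_left ih' hγ.le

theorem multinorm_bound {n N : ℕ} {V : Type} [Fintype V] [Nonempty V] (E : Set (V × V × Fin N))
    (A : Fin N → Matrix (Fin n) (Fin n) ℝ) (γ : ℝ) (hγ : 0 < γ) (ν : V → (Fin n → ℝ) → ℝ)
    (hν : IsMultinorm E A γ ν) :
    ∃ K : ℝ, 1 ≤ K ∧ ∀ (t : ℕ) (v : Fin (t + 1) → V) (σ : Fin t → Fin N),
      IsPath E v σ → euclOpNorm (pathProd A t σ) ≤ K * γ ^ t := by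
  have hq : ∀ u : V, ∃ K : ℝ, 1 ≤ K ∧ ∀ x : EuclideanSpace ℝ (Fin n),
      ν u x.ofLp ≤ K * ‖x‖ ∧ ‖x‖ ≤ K * ν u x.ofLp := by
    intro u
    obtain ⟨h1, h2, h3⟩ := hν.1 u
    exact seminorm_equiv (Seminorm.of (fun x : EuclideanSpace ℝ (Fin n) => ν u x.ofLp)
      (fun x y => h1 _ _) (fun a x => h2 _ _))
      (fun x hx => (WithLp.ofLp_eq_zero 2).mp (h3 _ hx))
  choose K hK1 hK using hq
  obtain ⟨M, hM⟩ := (Set.finite_range K).bddAbove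
  have hM : ∀ u, K u ≤ M := fun u => hM ⟨u, rfl⟩
  have hM1 : 1 ≤ M := (hK1 (Classical.arbitrary V)).trans (hM _)
  refine ⟨M * M, by nlinarith, fun t v σ h => ?_⟩
  have hg : 0 < γ ^ t := pow_pos hγ t
  unfold euclOpNorm
  refine ContinuousLinearMap.opNorm_le_bound _ (by positivity) (fun x => ?_)
  have key := multinorm_path E A γ hγ ν hν t v σ h x.ofLp
  have a := (hK (v (Fin.last t)) (Matrix.toEuclideanLin (pathProd A t σ) x)).2
  have b := (hK (v 0) x).1
  have e : (Matrix.toEuclideanLin (pathProd A t σ) x).ofLp = (pathProd A t σ).mulVec x.ofLp := rfl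
  rw [e] at a
  have hKp := hK1 (v (Fin.last t))
  calc ‖Matrix.toEuclideanLin (pathProd A t σ) x‖ ≤ _ := a
    _ ≤ K (v (Fin.last t)) * (γ ^ t * (K (v 0) * ‖x‖)) := by gcongr; exact key.trans (by gcongr)
    _ ≤ M * (γ ^ t * (M * ‖x‖)) := by
      have := hK1 (v 0)
      gcongr
      · exact hM _
      · exact hM _
    _ = M * M * γ ^ t * ‖x‖ := by ring

/-- a `γ`-multinorm implies `ρ̂(G, M) ≤ γ`. -/
theorem cjsr_le_of_multinorm {n N : ℕ} (hn : 1 ≤ n) (hN : 1 ≤ N)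
    {V : Type} [Fintype V] [Nonempty V]
    (E : Set (V × V × Fin N)) (A : Fin N → Matrix (Fin n) (Fin n) ℝ)
    (hconn : StronglyConnected E)
    (γ : ℝ) (hγ : 0 < γ) (ν : V → (Fin n → ℝ) → ℝ)
    (hν : IsMultinorm E A γ ν) :
    cjsr E A ≤ γ := by
  obtain ⟨K, hK1, hK⟩ := multinorm_bound E A γ hγ ν hν
  have hK0 : 0 < K := by linarith
  unfold cjsr
  have hlim : Tendsto (fun t : ℕ => K ^ (1 / (t : ℝ)) * γ) atTop (nhds γ) := by
    have h0 : Tendsto (fun t : ℕ => 1 / (t : ℝ)) atTop (nhds 0) :=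
      tendsto_one_div_atTop_nhds_zero_nat
    have h1 := (tendsto_const_nhds (x := K)).rpow h0 (Or.inl hK0.ne')
    simpa using h1.mul_const γ
  rw [← hlim.limsup_eq]
  refine limsup_le_limsup ?_ ?_ hlim.isBoundedUnder_le
  · filter_upwards [eventually_ge_atTop 1] with t ht
    have ht' : (t : ℝ) ≠ 0 := by positivity
    refine Real.sSup_le ?_ (by positivity)
    rintro x ⟨v, σ, h, rfl⟩
    have hb := hK t v σ h
    calc euclOpNorm (pathProd A t σ) ^ (1 / (t : ℝ)) ≤ (K * γ ^ t) ^ (1 / (t : ℝ)) :=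
          Real.rpow_le_rpow (norm_nonneg _) hb (by positivity)
      _ = K ^ (1 / (t : ℝ)) * γ := by
          rw [Real.mul_rpow hK0.le (by positivity), ← Real.rpow_natCast γ t,
            ← Real.rpow_mul hγ.le, mul_one_div_cancel ht', Real.rpow_one]
  · refine isCoboundedUnder_le_of_le atTop (x := 0) (fun t => ?_)
    refine Real.sSup_nonneg ?_
    rintro x ⟨v, σ, h, rfl⟩
    exact Real.rpow_nonneg (norm_nonneg _) _
end

section
/- The constrained switching system S(G, M) is stable if and only if it admits a Lyapunov multinorm, i.e. a γ-multinorm for some γ with 0 < γ < 1. -/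
open Filter Matrix

/-- Products of matrices along an infinite label sequence, defined recursively. -/
noncomputable def infProd {n N : ℕ} (A : Fin N → Matrix (Fin n) (Fin n) ℝ)
    (σ : ℕ → Fin N) : ℕ → Matrix (Fin n) (Fin n) ℝ
  | 0 => 1
  | t + 1 => A (σ t) * infProd A σ t

lemma pathProd_eq_infProd {n N : ℕ} (A : Fin N → Matrix (Fin n) (Fin n) ℝ)
    (σ : ℕ → Fin N) (t : ℕ) : pathProd A t (fun i : Fin t => σ i) = infProd A σ t := by
  induction t with
  | zero => simp [pathProd, infProd]
  | succ t ih =>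
    rw [infProd, ← ih]
    rw [pathProd, List.ofFn_succ']
    simp [pathProd, List.concat_eq_append, -List.ofFn_succ]

lemma infProd_add {n N : ℕ} (A : Fin N → Matrix (Fin n) (Fin n) ℝ)
    (σ : ℕ → Fin N) (s t : ℕ) :
    infProd A σ (s + t) = infProd A (fun k => σ (s + k)) t * infProd A σ s := by
  induction t with
  | zero => simp [infProd]
  | succ t ih => rw [← add_assoc, infProd, ih, infProd, Matrix.mul_assoc]

/-- Infinite paths. -/
def InfPath {V : Type} {N : ℕ} (E : Set (V × V × Fin N)) (p : (ℕ → V) × (ℕ → Fin N)) : Prop :=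
  ∀ t : ℕ, (p.1 t, p.1 (t + 1), p.2 t) ∈ E

lemma InfPath.shift {V : Type} {N : ℕ} {E : Set (V × V × Fin N)} {p : (ℕ → V) × (ℕ → Fin N)}
    (h : InfPath E p) (s : ℕ) :
    InfPath E (fun k => p.1 (s + k), fun k => p.2 (s + k)) := fun t => h (s + t)

lemma exists_infPath {V : Type} {N : ℕ} {E : Set (V × V × Fin N)} (hc : StronglyConnected E)
    (u : V) : ∃ p, InfPath E p ∧ p.1 0 = u := by
  have h : ∀ u : V, ∃ q : V × Fin N, (u, q.1, q.2) ∈ E := by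
    intro u
    obtain ⟨t, v, σ, ht, hp, h0, -⟩ := hc u u
    have := hp ⟨0, ht⟩
    refine ⟨(v (Fin.succ ⟨0, ht⟩), σ ⟨0, ht⟩), ?_⟩
    rw [← h0]; exact this
  choose f hf using h
  refine ⟨(fun k => (fun w => (f w).1)^[k] u, fun k => (f ((fun w => (f w).1)^[k] u)).2), ?_, rfl⟩
  intro t
  simp only [Function.iterate_succ_apply']
  exact hf _

lemma norm_lower {n : ℕ} (ν : (Fin n → ℝ) → ℝ)
    (h1 : ∀ x y : Fin n → ℝ, ν (x + y) ≤ ν x + ν y)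
    (h2 : ∀ (a : ℝ) (x : Fin n → ℝ), ν (a • x) = |a| * ν x)
    (h3 : ∀ x : Fin n → ℝ, ν x = 0 → x = 0) :
    ∃ c : ℝ, 0 < c ∧ ∀ x, c * ‖x‖ ≤ ν x := by
  let p : Seminorm ℝ (Fin n → ℝ) := Seminorm.of ν h1 h2
  have hp : ∀ x, p x = ν x := fun x => rfl
  have hcont : Continuous ν := by
    have := p.convexOn.continuousOn isOpen_univ
    exact continuousOn_univ.1 this
  rcases (Metric.sphere (0 : Fin n → ℝ) 1).eq_empty_or_nonempty with he | hne
  · refine ⟨1, one_pos, fun x => ?_⟩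
    by_cases hx : x = 0
    · subst hx; simp [← hp]
    · exfalso
      have : ‖x‖⁻¹ • x ∈ Metric.sphere (0 : Fin n → ℝ) 1 := by
        simp [norm_smul, hx]
      simp [he] at this
  · obtain ⟨y, hy, hmin⟩ := (isCompact_sphere (0 : Fin n → ℝ) 1).exists_isMinOn hne hcont.continuousOn
    have hy0 : y ≠ 0 := by
      rintro rfl; simp at hy
    have hpos : 0 < ν y := lt_of_le_of_ne (hp y ▸ apply_nonneg p y) (fun h => hy0 (h3 y h.symm))
    refine ⟨ν y, hpos, fun x => ?_⟩
    by_cases hx : x = 0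
    · subst hx; simp [← hp]
    · have hm : ‖x‖⁻¹ • x ∈ Metric.sphere (0 : Fin n → ℝ) 1 := by
        simp [norm_smul, hx]
      have h : ν y ≤ ν (‖x‖⁻¹ • x) := hmin hm
      have hxp : 0 < ‖x‖ := norm_pos_iff.2 hx
      rw [h2, abs_of_pos (inv_pos.2 hxp), inv_mul_eq_div, le_div_iff₀ hxp] at h
      exact h

lemma stable_of_multinorm {n N : ℕ} {V : Type} [Fintype V]
    (E : Set (V × V × Fin N)) (A : Fin N → Matrix (Fin n) (Fin n) ℝ)
    (γ : ℝ) (h0 : 0 < γ) (hlt : γ < 1) (ν : V → (Fin n → ℝ) → ℝ) (h : IsMultinorm E A γ ν) :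
    Stable E A := by
  intro v σ hp x
  simp only [pathProd_eq_infProd]
  choose c hc hcν using fun u => norm_lower (ν u) (h.1 u).1 (h.1 u).2.1 (h.1 u).2.2
  have hdec : ∀ t, ν (v t) ((infProd A σ t).mulVec x) ≤ γ ^ t * ν (v 0) x := by
    intro t
    induction t with
    | zero => simp [infProd]
    | succ t ih =>
      rw [infProd, ← Matrix.mulVec_mulVec]
      calc _ ≤ γ * ν (v t) ((infProd A σ t).mulVec x) := h.2 _ _ _ (hp t) _
        _ ≤ γ * (γ ^ t * ν (v 0) x) := by gcongr
        _ = _ := by ring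
  obtain ⟨D, hD⟩ := (Set.finite_range fun u => (c u)⁻¹).bddAbove
  have hν0 : 0 ≤ ν (v 0) x := le_trans (by have := hc (v 0); positivity) (hcν (v 0) x)
  have hb : ∀ t, ‖(infProd A σ t).mulVec x‖ ≤ γ ^ t * (D * ν (v 0) x) := by
    intro t
    have h1 := (hcν (v t) _).trans (hdec t)
    have h2 : (c (v t))⁻¹ ≤ D := hD ⟨_, rfl⟩
    rw [← le_inv_mul_iff₀ (hc _)] at h1
    calc _ ≤ _ := h1
      _ ≤ D * (γ ^ t * ν (v 0) x) := by gcongr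
      _ = _ := by ring
  apply squeeze_zero_norm hb
  simpa using (tendsto_pow_atTop_nhds_zero_of_lt_one h0.le hlt).mul_const (D * ν (v 0) x)

section
attribute [local instance] Matrix.linftyOpNormedAddCommGroup Matrix.linftyOpNormedSpace
  Matrix.linftyOpNormedRing

lemma exists_uniform_time {n N : ℕ} {V : Type} [Fintype V]
    (E : Set (V × V × Fin N)) (A : Fin N → Matrix (Fin n) (Fin n) ℝ) (h : Stable E A) :
    ∃ T : ℕ, ∀ p, InfPath E p → ∃ s, 1 ≤ s ∧ s ≤ T ∧
      ‖infProd A p.2 s‖ ≤ 1 / 2 := by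
  letI : TopologicalSpace V := ⊥
  haveI : DiscreteTopology V := ⟨rfl⟩
  have hclosed : IsClosed {p : (ℕ → V) × (ℕ → Fin N) | InfPath E p} := by
    have : {p : (ℕ → V) × (ℕ → Fin N) | InfPath E p} =
        ⋂ t : ℕ, (fun p : (ℕ → V) × (ℕ → Fin N) => (p.1 t, p.1 (t + 1), p.2 t)) ⁻¹' E := by
      ext p; simp [InfPath]
    rw [this]
    refine isClosed_iInter fun t => (isClosed_discrete E).preimage ?_
    fun_prop
  have hcompact := hclosed.isCompact
  have hcont : ∀ t, Continuous fun p : (ℕ → V) × (ℕ → Fin N) => infProd A p.2 t := by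
    intro t
    induction t with
    | zero => simpa [infProd] using continuous_const
    | succ t ih =>
      simp only [infProd]
      have : Continuous fun p : (ℕ → V) × (ℕ → Fin N) => A (p.2 t) :=
        (continuous_of_discreteTopology (f := A)).comp (by fun_prop)
      exact this.mul ih
  obtain ⟨F, hF⟩ := hcompact.elim_finite_subcover
    (fun t : ℕ => {p : (ℕ → V) × (ℕ → Fin N) | ‖infProd A p.2 (t + 1)‖ < 1 / 2})
    (fun t => isOpen_lt (hcont _).norm continuous_const) (by
      intro p hp
      have hten : Tendsto (fun t => infProd A p.2 t) atTop (nhds 0) := by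
        refine tendsto_pi_nhds.2 fun i => tendsto_pi_nhds.2 fun j => ?_
        have := h p.1 p.2 hp (Pi.single j 1)
        simp only [pathProd_eq_infProd] at this
        have := tendsto_pi_nhds.1 this i
        simpa using this
      have := (hten.norm.comp (tendsto_add_atTop_nat 1)).eventually_lt_const
        (u := 1 / 2) (by simp)
      obtain ⟨t, ht⟩ := this.exists
      exact Set.mem_iUnion.2 ⟨t, ht⟩)
  refine ⟨F.sup id + 1, fun p hp => ?_⟩
  obtain ⟨t, ht, htp⟩ := Set.mem_iUnion₂.1 (hF hp)
  exact ⟨t + 1, by omega, Nat.succ_le_succ (Finset.le_sup (f := id) ht), le_of_lt htp⟩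

lemma exists_exp_bound {n N : ℕ} {V : Type} [Fintype V]
    (E : Set (V × V × Fin N)) (A : Fin N → Matrix (Fin n) (Fin n) ℝ) (h : Stable E A) :
    ∃ ρ K : ℝ, 0 < ρ ∧ ρ < 1 ∧ ∀ t p, InfPath E p → ∀ x : Fin n → ℝ,
      ρ⁻¹ ^ t * ‖(infProd A p.2 t).mulVec x‖ ≤ K * ‖x‖ := by
  obtain ⟨T, hT⟩ := exists_uniform_time E A h
  obtain ⟨ρ, hρ0, hρ1, hρT⟩ : ∃ ρ : ℝ, 0 < ρ ∧ ρ < 1 ∧ ρ⁻¹ ^ T ≤ 2 := by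
    have hc : ContinuousAt (fun r : ℝ => r⁻¹ ^ T) 1 := by
      apply ContinuousAt.pow; exact continuousAt_inv₀ one_ne_zero
    have h1 : ∀ᶠ r in nhds (1 : ℝ), r⁻¹ ^ T < 2 ∧ 0 < r :=
      (hc.eventually_lt_const (by norm_num)).and (lt_mem_nhds one_pos)
    obtain ⟨r, hr, hr1⟩ := ((h1.filter_mono nhdsWithin_le_nhds).and
      (self_mem_nhdsWithin (a := (1 : ℝ)) (s := Set.Iio 1))).exists
    exact ⟨r, hr.2, hr1, hr.1.le⟩
  have hone : 1 ≤ ρ⁻¹ := (one_le_inv₀ hρ0).2 hρ1.le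
  obtain ⟨a, ha⟩ := (Set.finite_range fun i => ‖A i‖).bddAbove
  set b := max a 1 with hb
  have hb1 : 1 ≤ b := le_max_right _ _
  have hAb : ∀ i, ‖A i‖ ≤ b := fun i => (ha ⟨i, rfl⟩).trans (le_max_left _ _)
  have hgrow : ∀ (σ : ℕ → Fin N) t (x : Fin n → ℝ),
      ‖(infProd A σ t).mulVec x‖ ≤ b ^ t * ‖x‖ := by
    intro σ t x
    induction t with
    | zero => simp [infProd]
    | succ t ih =>
      rw [infProd, ← Matrix.mulVec_mulVec]
      calc _ ≤ ‖A (σ t)‖ * ‖(infProd A σ t).mulVec x‖ := Matrix.linfty_opNorm_mulVec _ _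
        _ ≤ b * (b ^ t * ‖x‖) := by gcongr; exact hAb _
        _ = _ := by ring
  refine ⟨ρ, 2 * b ^ T, hρ0, hρ1, ?_⟩
  intro t
  induction t using Nat.strong_induction_on with
  | _ t ih =>
    intro p hp x
    obtain ⟨s, hs1, hsT, hs⟩ := hT p hp
    have hsT2 : ρ⁻¹ ^ s ≤ 2 := (pow_le_pow_right₀ hone hsT).trans hρT
    rcases lt_or_ge t s with hts | hst
    · have htT : t ≤ T := by omega
      calc _ ≤ 2 * (b ^ T * ‖x‖) := by
            gcongr
            · exact (pow_le_pow_right₀ hone htT).trans hρT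
            · refine (hgrow _ _ _).trans ?_
              gcongr
        _ = _ := by ring
    · obtain ⟨r, rfl⟩ := Nat.exists_eq_add_of_le hst
      have hi := ih r (by omega) _ (hp.shift s) ((infProd A p.2 s).mulVec x)
      rw [infProd_add, ← Matrix.mulVec_mulVec, pow_add, mul_assoc]
      calc _ ≤ ρ⁻¹ ^ s * (2 * b ^ T * ‖(infProd A p.2 s).mulVec x‖) := by gcongr
        _ ≤ 2 * (2 * b ^ T * (1 / 2 * ‖x‖)) := by
          gcongr
          refine (Matrix.linfty_opNorm_mulVec _ _).trans ?_
          gcongr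
        _ = _ := by ring

end

lemma multinorm_of_stable {n N : ℕ} {V : Type} [Fintype V]
    (E : Set (V × V × Fin N)) (A : Fin N → Matrix (Fin n) (Fin n) ℝ)
    (hconn : StronglyConnected E) (h : Stable E A) :
    ∃ γ : ℝ, 0 < γ ∧ γ < 1 ∧ ∃ ν : V → (Fin n → ℝ) → ℝ, IsMultinorm E A γ ν := by
  obtain ⟨ρ, K, hρ0, hρ1, hK⟩ := exists_exp_bound E A h
  let I : V → Type := fun u => {p : (ℕ → V) × (ℕ → Fin N) // InfPath E p ∧ p.1 0 = u} × ℕ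
  let g : ∀ u, (Fin n → ℝ) → I u → ℝ := fun u x q =>
    ρ⁻¹ ^ q.2 * ‖(infProd A q.1.1.2 q.2).mulVec x‖
  have hI : ∀ u, Nonempty (I u) := fun u => by
    obtain ⟨p, hp⟩ := exists_infPath hconn u
    exact ⟨(⟨p, hp⟩, 0)⟩
  have hbdd : ∀ u x, BddAbove (Set.range (g u x)) := by
    rintro u x
    refine ⟨K * ‖x‖, ?_⟩
    rintro _ ⟨q, rfl⟩
    exact hK _ _ q.1.2.1 x
  refine ⟨ρ, hρ0, hρ1, fun u x => ⨆ q, g u x q, fun u => ⟨?_, ?_, ?_⟩, ?_⟩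
  · intro x y
    refine ciSup_le fun q => ?_
    refine le_trans ?_ (add_le_add (le_ciSup (hbdd u x) q) (le_ciSup (hbdd u y) q))
    simp only [g, Matrix.mulVec_add, ← mul_add]
    gcongr
    exact norm_add_le _ _
  · intro a x
    simp only []
    rw [Real.mul_iSup_of_nonneg (abs_nonneg a)]
    congr 1
    funext q
    simp only [g, Matrix.mulVec_smul, norm_smul, Real.norm_eq_abs]
    ring
  · intro x hx
    obtain ⟨p, hp⟩ := exists_infPath hconn u
    have := le_ciSup (hbdd u x) (⟨p, hp⟩, 0)
    simp only [] at hx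
    rw [hx] at this
    simpa [g, infProd] using this
  · intro vi vj σ he x
    refine ciSup_le fun q => ?_
    obtain ⟨⟨p, hp, hp0⟩, t⟩ := q
    let p' : (ℕ → V) × (ℕ → Fin N) :=
      (fun k => Nat.casesOn k vi p.1, fun k => Nat.casesOn k σ p.2)
    have hp' : InfPath E p' := by
      intro k
      cases k with
      | zero => simpa [p', hp0] using he
      | succ k => exact hp k
    have hle := le_ciSup (hbdd vi x) (⟨p', hp', rfl⟩, t + 1)
    have hprod : infProd A p'.2 (t + 1) = infProd A p.2 t * A σ := by
      rw [add_comm, infProd_add]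
      have h1 : (fun k => p'.2 (1 + k)) = p.2 := by
        funext k; rw [add_comm]
      rw [h1]
      simp [infProd, p']
    refine le_trans (le_of_eq ?_) (mul_le_mul_of_nonneg_left hle hρ0.le)
    simp only [g]
    rw [hprod, Matrix.mulVec_mulVec, pow_succ]
    field_simp

/-- `S(G, M)` is stable iff it admits a Lyapunov multinorm. -/
theorem stable_iff_exists_lyapunov_multinorm {n N : ℕ} (hn : 1 ≤ n) (hN : 1 ≤ N)
    {V : Type} [Fintype V] [Nonempty V]
    (E : Set (V × V × Fin N)) (A : Fin N → Matrix (Fin n) (Fin n) ℝ)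
    (hconn : StronglyConnected E) :
    Stable E A ↔ ∃ γ : ℝ, 0 < γ ∧ γ < 1 ∧
      ∃ ν : V → (Fin n → ℝ) → ℝ, IsMultinorm E A γ ν := by
  exact ⟨multinorm_of_stable E A hconn,
    fun ⟨γ, h0, h1, ν, h⟩ => stable_of_multinorm E A γ h0 h1 ν h⟩
end

section
/- For every ε > 0, the system S(G, M) admits a quadratic γ-multinorm with γ = √n · (ρ̂(G, M) + ε). -/
open Filter Matrix

section Helpers

open scoped Matrix.Norms.L2Operator MatrixOrder

lemma aux_factor {n : ℕ} {Q : Matrix (Fin n) (Fin n) ℝ} (hQ : Q.PosSemidef) :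
    ∃ C : Matrix (Fin n) (Fin n) ℝ, Q = Cᵀ * C := by
  obtain ⟨y, hy⟩ := CStarAlgebra.nonneg_iff_eq_star_mul_self.mp hQ.nonneg
  exact ⟨y, by simpa [star_eq_conjTranspose] using hy⟩

lemma aux_trace_bound {n : ℕ} (F : Matrix (Fin n) (Fin n) ℝ) (c : ℝ)
    (hc : (Fᵀ * F).trace ≤ c) :
    (c • (1 : Matrix (Fin n) (Fin n) ℝ) - Fᵀ * F).PosSemidef := by
  refine .of_dotProduct_mulVec_nonneg ?_ ?_
  · simp [Matrix.IsHermitian, conjTranspose_eq_transpose_of_trivial]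
  · intro x
    have h1 : star x ⬝ᵥ ((c • (1 : Matrix (Fin n) (Fin n) ℝ) - Fᵀ * F) *ᵥ x)
        = c * ∑ i, x i ^ 2 - ∑ j, (∑ i, F j i * x i) ^ 2 := by
      rw [sub_mulVec, dotProduct_sub, smul_mulVec, one_mulVec, ← mulVec_mulVec,
        dotProduct_mulVec, vecMul_transpose]
      simp [dotProduct, mulVec, Finset.mul_sum, pow_two]
      exact Finset.sum_congr rfl fun i _ => by ring
    have h2 : (Fᵀ * F).trace = ∑ j, ∑ i, F j i ^ 2 := by
      rw [Finset.sum_comm]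
      simp [trace, Matrix.mul_apply, pow_two]
    rw [h1, sub_nonneg]
    calc ∑ j, (∑ i, F j i * x i) ^ 2
        ≤ ∑ j, (∑ i, F j i ^ 2) * ∑ i, x i ^ 2 :=
          Finset.sum_le_sum fun j _ => Finset.sum_mul_sq_le_sq_mul_sq _ _ _
      _ = (Fᵀ * F).trace * ∑ i, x i ^ 2 := by rw [h2, Finset.sum_mul]
      _ ≤ c * ∑ i, x i ^ 2 := by
          apply mul_le_mul_of_nonneg_right hc
          positivity

lemma aux_loewner {n : ℕ} {Q B : Matrix (Fin n) (Fin n) ℝ} (hQ : Q.PosDef)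
    (hB : B.PosSemidef) (c : ℝ) (h : (Q⁻¹ * B).trace ≤ c) :
    (c • Q - B).PosSemidef := by
  obtain ⟨C, hC⟩ := aux_factor hQ.posSemidef
  obtain ⟨D, hD⟩ := aux_factor hB
  have hdet : IsUnit C.det := by
    have h0 := hQ.det_pos.ne'
    rw [hC, det_mul] at h0
    exact isUnit_iff_ne_zero.2 (right_ne_zero_of_mul h0)
  have hCC : C⁻¹ * C = 1 := nonsing_inv_mul _ hdet
  have hF : D = (D * C⁻¹) * C := by rw [Matrix.mul_assoc, hCC, Matrix.mul_one]
  have htr : ((D * C⁻¹)ᵀ * (D * C⁻¹)).trace ≤ c := by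
    refine le_of_eq_of_le ?_ h
    rw [hC, hD, Matrix.mul_inv_rev, transpose_mul, ← transpose_nonsing_inv]
    rw [← Matrix.mul_assoc, Matrix.trace_mul_comm]
    simp only [Matrix.mul_assoc]
  have h3 := (aux_trace_bound _ c htr).conjTranspose_mul_mul_same C
  rw [conjTranspose_eq_transpose_of_trivial] at h3
  convert h3 using 1
  rw [Matrix.mul_sub, Matrix.sub_mul, hC, hD]
  congr 1
  · simp
  · conv_lhs => rw [hF]
    simp only [transpose_mul, Matrix.mul_assoc]

lemma aux_trace_le {n : ℕ} (X : Matrix (Fin n) (Fin n) ℝ)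
    (h : ∀ s : ℝ, 0 < s → s ≤ 1 → (1 + s • X).det ≤ 1) : X.trace ≤ 0 := by
  set p := (det (1 + (Polynomial.X : Polynomial ℝ) • X.map Polynomial.C)).divX.divX with hp
  have h1 : ∀ s : ℝ, 0 < s → s ≤ 1 → X.trace + p.eval s * s ≤ 0 := by
    intro s hs hs1
    have := h s hs hs1
    rw [det_one_add_smul] at this
    have h2 : (X.trace + p.eval s * s) * s ≤ 0 := by
      rw [hp]; nlinarith
    by_contra hcon
    push Not at hcon
    have := mul_pos hcon hs
    linarith
  have hcont : Continuous fun s : ℝ => X.trace + p.eval s * s := by fun_prop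
  have ht : Tendsto (fun s : ℝ => X.trace + p.eval s * s) (nhdsWithin 0 (Set.Ioi 0))
      (nhds X.trace) := by
    have := (hcont.tendsto 0).mono_left (nhdsWithin_le_nhds (s := Set.Ioi 0))
    simpa using this
  refine le_of_tendsto ht ?_
  filter_upwards [Ioc_mem_nhdsGT (zero_lt_one (α := ℝ))] with s hs
  exact h1 s hs.1 hs.2

/-- A determinant-maximizing element of a compact convex set of PSD matrices. -/
lemma aux_john {n : ℕ} (K : Set (Matrix (Fin n) (Fin n) ℝ)) (hK : IsCompact K)
    (hconv : Convex ℝ K) (hone : 1 ∈ K) (hpsd : ∀ B ∈ K, B.PosSemidef) :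
    ∃ Q ∈ K, Q.PosDef ∧ ∀ B ∈ K, ((n : ℝ) • Q - B).PosSemidef := by
  have hcont : Continuous fun B : Matrix (Fin n) (Fin n) ℝ => B.det :=
    continuous_id.matrix_det
  obtain ⟨Q, hQK, hQ⟩ := hK.exists_isMaxOn ⟨1, hone⟩ hcont.continuousOn
  have hdet : 0 < Q.det := by
    have := hQ hone
    simp at this
    linarith
  have hQpd : Q.PosDef := (hpsd Q hQK).posDef_iff_det_ne_zero.2 hdet.ne'
  refine ⟨Q, hQK, hQpd, fun B hB => aux_loewner hQpd (hpsd B hB) _ ?_⟩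
  have hQQ : Q * Q⁻¹ = 1 := mul_nonsing_inv _ (isUnit_iff_ne_zero.2 hdet.ne')
  have hQQ' : Q⁻¹ * Q = 1 := nonsing_inv_mul _ (isUnit_iff_ne_zero.2 hdet.ne')
  have h := aux_trace_le (Q⁻¹ * (B - Q)) (by
    intro s hs hs1
    have hmem : (1 - s) • Q + s • B ∈ K :=
      hconv hQK hB (by linarith) hs.le (by ring)
    have h1 : (1 - s) • Q + s • B = Q * (1 + s • (Q⁻¹ * (B - Q))) := by
      rw [Matrix.mul_add, Matrix.mul_smul, ← Matrix.mul_assoc, hQQ, Matrix.one_mul,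
        Matrix.mul_one, smul_sub, sub_smul, one_smul]
      abel
    have h2 : ((1 - s) • Q + s • B).det ≤ Q.det := hQ hmem
    rw [h1, det_mul] at h2
    by_contra hcon
    push Not at hcon
    nlinarith)
  rw [Matrix.mul_sub, hQQ', trace_sub, trace_one, Fintype.card_fin] at h
  linarith

lemma euclOpNorm_eq {n : ℕ} (A : Matrix (Fin n) (Fin n) ℝ) : euclOpNorm A = ‖A‖ := rfl

lemma pathProd_cons {n N : ℕ} (A : Fin N → Matrix (Fin n) (Fin n) ℝ) (t : ℕ)
    (s : Fin N) (σ : Fin t → Fin N) :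
    pathProd A (t + 1) (Fin.cons s σ : Fin (t + 1) → Fin N) = pathProd A t σ * A s := by
  simp [pathProd, List.ofFn_succ]

lemma pathProd_norm_le {n N : ℕ} (A : Fin N → Matrix (Fin n) (Fin n) ℝ) (M : ℝ)
    (hM1 : ‖(1 : Matrix (Fin n) (Fin n) ℝ)‖ ≤ 1)
    (hM0 : 0 ≤ M) (hM : ∀ i, ‖A i‖ ≤ M) (t : ℕ) (σ : Fin t → Fin N) :
    ‖pathProd A t σ‖ ≤ M ^ t := by
  induction t with
  | zero => simpa [pathProd] using hM1
  | succ t ih =>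
    rw [← Fin.cons_self_tail σ, pathProd_cons, pow_succ]
    exact (norm_mul_le _ _).trans
      (mul_le_mul (ih _) (hM _) (norm_nonneg _) (pow_nonneg hM0 _))

lemma aux_growth {n N : ℕ} {V : Type} [Fintype V]
    (E : Set (V × V × Fin N)) (A : Fin N → Matrix (Fin n) (Fin n) ℝ)
    (ε : ℝ) (hε : 0 < ε) : 0 < cjsr E A + ε ∧
    ∃ C : ℝ, 0 ≤ C ∧ ∀ (t : ℕ) (v : Fin (t + 1) → V) (σ : Fin t → Fin N), IsPath E v σ →
      ‖pathProd A t σ‖ ≤ C * (cjsr E A + ε) ^ t := by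
  have hM1 : ‖(1 : Matrix (Fin n) (Fin n) ℝ)‖ ≤ 1 := by
    rw [← diagonal_one, l2_opNorm_diagonal]
    exact (pi_norm_le_iff_of_nonneg zero_le_one).2 (by simp)
  set M : ℝ := ∑ i, ‖A i‖ with hMdef
  have hM0 : 0 ≤ M := Finset.sum_nonneg fun _ _ => norm_nonneg _
  have hM : ∀ i, ‖A i‖ ≤ M := fun i =>
    Finset.single_le_sum (f := fun i => ‖A i‖) (fun _ _ => norm_nonneg _) (Finset.mem_univ i)
  have hP := pathProd_norm_le A M hM1 hM0 hM
  set S : ℕ → Set ℝ := fun t => { x : ℝ | ∃ (v : Fin (t + 1) → V) (σ : Fin t → Fin N),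
      IsPath E v σ ∧ x = euclOpNorm (pathProd A t σ) ^ (1 / (t : ℝ)) } with hS
  have hSM : ∀ t, 1 ≤ t → ∀ x ∈ S t, x ≤ M := by
    rintro t ht x ⟨v, σ, -, rfl⟩
    have ht' : (t : ℝ) ≠ 0 := by positivity
    calc euclOpNorm (pathProd A t σ) ^ (1 / (t : ℝ)) ≤ (M ^ t) ^ (1 / (t : ℝ)) :=
          Real.rpow_le_rpow (norm_nonneg _) (hP t σ) (by positivity)
      _ = M := by
          rw [← Real.rpow_natCast, ← Real.rpow_mul hM0, mul_one_div_cancel ht', Real.rpow_one]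
  have hbdd : IsBoundedUnder (· ≤ ·) atTop fun t => sSup (S t) := by
    refine isBoundedUnder_of_eventually_le (a := M) ?_
    filter_upwards [eventually_ge_atTop 1] with t ht
    exact Real.sSup_le (hSM t ht) hM0
  have hnn : ∀ t, 0 ≤ sSup (S t) := fun t => Real.sSup_nonneg (by
    rintro x ⟨v, σ, -, rfl⟩
    exact Real.rpow_nonneg (norm_nonneg _) _)
  have hc : cjsr E A = limsup (fun t => sSup (S t)) atTop := rfl
  have hc0 : 0 ≤ cjsr E A := by
    rw [hc]
    exact le_limsup_of_frequently_le (Frequently.of_forall hnn) hbdd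
  have hr : 0 < cjsr E A + ε := by linarith
  refine ⟨hr, ?_⟩
  set r := cjsr E A + ε with hrdef
  have hev : ∀ᶠ t in atTop, sSup (S t) < r :=
    eventually_lt_of_limsup_lt (by rw [← hc]; linarith) hbdd
  obtain ⟨T, hT⟩ := eventually_atTop.1 hev
  have hs0 : ∀ t ∈ Finset.range (T + 1), 0 ≤ (M / r) ^ t := fun t _ => by positivity
  refine ⟨1 + ∑ t ∈ Finset.range (T + 1), (M / r) ^ t,
    by linarith [Finset.sum_nonneg hs0], fun t v σ hp => ?_⟩
  by_cases htT : t < T + 1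
  · have h1 : (M / r) ^ t ≤ ∑ t ∈ Finset.range (T + 1), (M / r) ^ t :=
      Finset.single_le_sum hs0 (Finset.mem_range.2 htT)
    calc ‖pathProd A t σ‖ ≤ M ^ t := hP t σ
      _ = (M / r) ^ t * r ^ t := by rw [← mul_pow, div_mul_cancel₀ _ hr.ne']
      _ ≤ _ := by
        apply mul_le_mul_of_nonneg_right _ (by positivity)
        linarith
  · have ht1 : 1 ≤ t := by omega
    have ht' : (t : ℝ) ≠ 0 := by positivity
    have h1 : euclOpNorm (pathProd A t σ) ^ (1 / (t : ℝ)) ≤ r :=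
      (le_csSup ⟨M, fun x hx => hSM t ht1 x hx⟩ ⟨v, σ, hp, rfl⟩).trans (hT t (by omega)).le
    have h2 : ‖pathProd A t σ‖ ≤ r ^ t := by
      have h3 := pow_le_pow_left₀ (Real.rpow_nonneg (norm_nonneg _) _) h1 t
      rw [← Real.rpow_natCast, ← Real.rpow_mul (norm_nonneg _), one_div_mul_cancel ht',
        Real.rpow_one] at h3
      exact h3
    calc ‖pathProd A t σ‖ ≤ 1 * r ^ t := by simpa using h2
      _ ≤ _ := by
        apply mul_le_mul_of_nonneg_right _ (by positivity)
        linarith [Finset.sum_nonneg hs0]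

lemma isPath_cons {V : Type*} {N : ℕ} (E : Set (V × V × Fin N)) {t : ℕ}
    (v : Fin (t + 1) → V) (σ : Fin t → Fin N) (h : IsPath E v σ) (u : V) (s : Fin N)
    (he : (u, v 0, s) ∈ E) :
    IsPath E (Fin.cons u v : Fin (t + 2) → V) (Fin.cons s σ : Fin (t + 1) → Fin N) := by
  intro i
  refine Fin.cases ?_ (fun i => ?_) i
  · simpa using he
  · simpa [Fin.castSucc_succ] using h i

lemma aux_closed_psd {n : ℕ} :
    IsClosed {B : Matrix (Fin n) (Fin n) ℝ | B.PosSemidef} := by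
  simp only [posSemidef_iff_dotProduct_mulVec, Set.setOf_and, Set.setOf_forall]
  refine IsClosed.inter ?_ (isClosed_iInter fun x => ?_)
  · exact isClosed_eq (continuous_id.matrix_conjTranspose) continuous_id
  · exact isClosed_le continuous_const
      (continuous_const.dotProduct (continuous_id.matrix_mulVec continuous_const))

lemma aux_main {n N : ℕ} {V : Type} [Fintype V]
    (E : Set (V × V × Fin N)) (A : Fin N → Matrix (Fin n) (Fin n) ℝ)
    (r C : ℝ) (hr : 0 < r) (hC0 : 0 ≤ C)
    (hC : ∀ (t : ℕ) (v : Fin (t + 1) → V) (σ : Fin t → Fin N), IsPath E v σ →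
      ‖pathProd A t σ‖ ≤ C * r ^ t) :
    ∃ Q : V → Matrix (Fin n) (Fin n) ℝ, IsQuadMultinorm E A (Real.sqrt n * r) Q := by
  set S : V → Set (Matrix (Fin n) (Fin n) ℝ) := fun u =>
    {B | ∃ (t : ℕ) (v : Fin (t + 1) → V) (σ : Fin t → Fin N), IsPath E v σ ∧ v 0 = u ∧
      B = ((r ^ t)⁻¹ ^ 2) • ((pathProd A t σ)ᵀ * pathProd A t σ)} with hS
  have hpsd : ∀ u, closedConvexHull ℝ (S u) ⊆ {B | B.PosSemidef} := by
    intro u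
    refine closedConvexHull_min ?_ ?_ aux_closed_psd
    · rintro B ⟨t, v, σ, -, -, rfl⟩
      refine PosSemidef.smul ?_ (by positivity)
      simpa using posSemidef_conjTranspose_mul_self (pathProd A t σ)
    · intro x hx y hy a b ha hb _
      exact (PosSemidef.smul hx ha).add (PosSemidef.smul hy hb)
  have hball : ∀ u, closedConvexHull ℝ (S u) ⊆ Metric.closedBall 0 (C ^ 2) := by
    intro u
    refine closedConvexHull_min ?_ (convex_closedBall _ _) Metric.isClosed_closedBall
    rintro B ⟨t, v, σ, hp, -, rfl⟩
    rw [mem_closedBall_zero_iff, norm_smul, ← conjTranspose_eq_transpose_of_trivial,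
      l2_opNorm_conjTranspose_mul_self, Real.norm_of_nonneg (by positivity)]
    have h1 := hC t v σ hp
    have hrt : 0 < r ^ t := by positivity
    have h2 : (r ^ t)⁻¹ * ‖pathProd A t σ‖ ≤ C := by
      rw [inv_mul_le_iff₀ hrt]; linarith
    calc _ = ((r ^ t)⁻¹ * ‖pathProd A t σ‖) ^ 2 := by ring
      _ ≤ C ^ 2 := pow_le_pow_left₀ (by positivity) h2 2
  have hcomp : ∀ u, IsCompact (closedConvexHull ℝ (S u)) := fun u =>
    haveI : ProperSpace (Matrix (Fin n) (Fin n) ℝ) := FiniteDimensional.proper ℝ _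
    Metric.isCompact_of_isClosed_isBounded isClosed_closedConvexHull
      (Metric.isBounded_closedBall.subset (hball u))
  have hone : ∀ u, 1 ∈ closedConvexHull ℝ (S u) := fun u => by
    refine subset_closedConvexHull ⟨0, fun _ => u, Fin.elim0, fun i => i.elim0, rfl, ?_⟩
    simp [pathProd]
  choose Q hQK hQpd hQ using fun u => aux_john _ (hcomp u) convex_closedConvexHull (hone u)
    (hpsd u)
  refine ⟨Q, hQpd, fun vi vj s he => ?_⟩
  have hmap : closedConvexHull ℝ (S vj) ⊆
      {B | (r⁻¹ ^ 2) • ((A s)ᵀ * B * A s) ∈ closedConvexHull ℝ (S vi)} := by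
    refine closedConvexHull_min ?_ ?_ ?_
    · rintro B ⟨t, v, σ, hp, rfl, rfl⟩
      refine subset_closedConvexHull ⟨t + 1, Fin.cons vi v, Fin.cons s σ,
        isPath_cons E v σ hp vi s he, rfl, ?_⟩
      rw [pathProd_cons, transpose_mul, Matrix.mul_smul, Matrix.smul_mul, smul_smul]
      congr 1
      · rw [pow_succ r t, mul_inv]; ring
      · simp only [Matrix.mul_assoc]
    · intro x hx y hy a b ha hb hab
      have := convex_closedConvexHull hx hy ha hb hab
      simp only [Set.mem_setOf_eq]
      convert this using 1
      simp only [Matrix.mul_add, Matrix.add_mul, Matrix.mul_smul, Matrix.smul_mul, smul_add]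
      rw [smul_comm a, smul_comm b]
    · refine isClosed_closedConvexHull.preimage
        (f := fun B => (r⁻¹ ^ 2) • ((A s)ᵀ * B * A s)) ?_
      fun_prop
  have h1 := (hQ vi _ (hmap (hQK vj))).smul (sq_nonneg r)
  convert h1 using 1
  rw [smul_sub, smul_smul, smul_smul, mul_pow, Real.sq_sqrt (Nat.cast_nonneg n)]
  congr 1
  · rw [mul_comm]
  · rw [← mul_pow, mul_inv_cancel₀ hr.ne']; simp

end Helpers

/-- for every `ε > 0` there is a quadratic `γ`-multinorm with
`γ = √n (ρ̂(G,M) + ε)`. -/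
theorem exists_quad_multinorm {n N : ℕ} (hn : 1 ≤ n) (hN : 1 ≤ N)
    {V : Type} [Fintype V] [Nonempty V]
    (E : Set (V × V × Fin N)) (A : Fin N → Matrix (Fin n) (Fin n) ℝ)
    (hconn : StronglyConnected E) :
    ∀ ε : ℝ, 0 < ε → ∃ Q : V → Matrix (Fin n) (Fin n) ℝ,
      IsQuadMultinorm E A (Real.sqrt n * (cjsr E A + ε)) Q := by
  intro ε hε
  obtain ⟨hr, C, hC0, hC⟩ := aux_growth E A ε hε
  exact aux_main E A _ C hr hC0 hC
end
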